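/- Let σ ∈ ℕ with σ ≥ 1. For z = (z_1, …, z_m) with z_k ∈ ℝ², let D_z ∈ ℝ^(2m×m) be the block-diagonal matrix whose k-th diagonal block is the column vector z_k (i.e. (D_z)_{(k,i),k'} = z_{k,i} if k = k' and 0 otherwise), and let D_{Q(z)} be the corresponding matrix built from the componentwise quantized blocks Q(z_k). Then the ℓ²→ℓ² operator norm satisfies ‖D_z − D_{Q(z)}‖ ≤ (0.5/10^(σ−1))·‖z‖, where ‖z‖ is the Euclidean norm of z ∈ ℝ^(2m). -/

import Mathlib

/-- Base-10 scaling factor of the mixed uniform-logarithmic quantizer (MULQ):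
`S(x) = 10^(σ - ⌊log₁₀ |x|⌋ - 1)`. -/
noncomputable def mulqS (σ : ℕ) (x : ℝ) : ℝ :=
  (10 : ℝ) ^ ((σ : ℤ) - ⌊Real.logb 10 |x|⌋ - 1)

/-- The mixed uniform-logarithmic quantizer: `Q(x) = (1/S(x)) ⬝ round (S(x)·x)`, `Q(0) = 0`. -/
noncomputable def mulqQ (σ : ℕ) (x : ℝ) : ℝ :=
  if x = 0 then 0 else (round (mulqS σ x * x) : ℤ) / mulqS σ x

/-- The `2m × m` block-diagonal matrix `D_z` whose `k`-th diagonal block is the column vector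
`z_k ∈ ℝ²`; rows are indexed by pairs `(k, i)` with `k` an edge and `i ∈ Fin 2` a coordinate. -/
def blockDiag (m : ℕ) (z : Fin m × Fin 2 → ℝ) : Matrix (Fin m × Fin 2) (Fin m) ℝ :=
  fun p k => if p.1 = k then z p else 0

lemma mulqS_pos (σ : ℕ) (x : ℝ) : 0 < mulqS σ x := by
  unfold mulqS
  positivity

/-- Scaling a nonzero `x` by `S(x)` yields at least `σ` digits before the decimal point. -/
lemma pow_le_mulqS_mul_abs {σ : ℕ} (hσ : 1 ≤ σ) {x : ℝ} (hx : x ≠ 0) :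
    (10 : ℝ) ^ (σ - 1) ≤ mulqS σ x * |x| := by
  have hfloor : (10 : ℝ) ^ ⌊Real.logb 10 |x|⌋ ≤ |x| := by
    rw [← Real.rpow_intCast, ← Real.le_logb_iff_rpow_le (by norm_num) (abs_pos.mpr hx)]
    exact Int.floor_le _
  have hexp : (10 : ℝ) ^ (σ - 1) = mulqS σ x * (10 : ℝ) ^ ⌊Real.logb 10 |x|⌋ := by
    rw [mulqS, ← zpow_add₀ (by norm_num), ← zpow_natCast]
    congr 1
    push_cast [hσ]
    ring
  rw [hexp]
  exact mul_le_mul_of_nonneg_left hfloor (mulqS_pos σ x).le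

/-- The relative error of the quantizer is at most `0.5 / 10 ^ (σ - 1)`. -/
lemma abs_sub_mulqQ_le {σ : ℕ} (hσ : 1 ≤ σ) (x : ℝ) :
    |x - mulqQ σ x| ≤ 0.5 / 10 ^ (σ - 1) * |x| := by
  by_cases hx : x = 0
  · simp [mulqQ, hx]
  have hS := mulqS_pos σ x
  have hsub : x - mulqQ σ x = (mulqS σ x * x - round (mulqS σ x * x)) / mulqS σ x := by
    rw [mulqQ, if_neg hx]
    field_simp
  rw [hsub, abs_div, abs_of_pos hS, div_mul_eq_mul_div, div_le_div_iff₀ hS (by positivity)]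
  calc |mulqS σ x * x - round (mulqS σ x * x)| * 10 ^ (σ - 1)
      ≤ (1 / 2) * (mulqS σ x * |x|) :=
        mul_le_mul (abs_sub_round _) (pow_le_mulqS_mul_abs hσ hx) (by positivity) (by norm_num)
    _ = 0.5 * |x| * mulqS σ x := by ring

lemma blockDiag_sub (m : ℕ) (u v : Fin m × Fin 2 → ℝ) :
    blockDiag m u - blockDiag m v = blockDiag m (u - v) := by
  ext p k
  by_cases h : p.1 = k <;> simp [blockDiag, h]

lemma blockDiag_mulVec (m : ℕ) (z : Fin m × Fin 2 → ℝ) (w : Fin m → ℝ) (p : Fin m × Fin 2) :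
    (blockDiag m z).mulVec w p = z p * w p.1 := by
  simp [Matrix.mulVec, dotProduct, blockDiag]

/-- The operator norm of `D_e` is controlled by any Euclidean vector dominating `e` entrywise. -/
lemma opNorm_blockDiag_le {m : ℕ} {e : Fin m × Fin 2 → ℝ} {c : ℝ} (hc : 0 ≤ c)
    {z : EuclideanSpace ℝ (Fin m × Fin 2)} (he : ∀ p, |e p| ≤ c * |z p|) :
    ‖(Matrix.toEuclideanLin (blockDiag m e)).toContinuousLinearMap‖ ≤ c * ‖z‖ := by
  refine ContinuousLinearMap.opNorm_le_bound _ (by positivity) fun w => ?_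
  refine abs_le_of_sq_le_sq' ?_ (by positivity) |>.2
  rw [mul_pow, mul_pow, EuclideanSpace.real_norm_sq_eq, EuclideanSpace.real_norm_sq_eq z,
    Finset.mul_sum, Finset.sum_mul]
  refine Finset.sum_le_sum fun p _ => ?_
  have hcoord : (Matrix.toEuclideanLin (blockDiag m e)).toContinuousLinearMap w p
      = e p * w p.1 := blockDiag_mulVec m e w p
  rw [hcoord, mul_pow, ← mul_pow c]
  refine mul_le_mul ?_ ?_ (sq_nonneg _) (sq_nonneg _)
  · refine sq_le_sq.mpr ?_
    rw [abs_mul, abs_of_nonneg hc]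
    exact he p
  · refine sq_le_sq.mpr ?_
    rw [abs_norm]
    exact PiLp.norm_apply_le w p.1

/-- Operator-norm bound `‖D_z − D_{Q(z)}‖ ≤ (0.5/10^(σ−1))·‖z‖`, where the matrix norm is the
one induced by the Euclidean norms and `‖z‖` is the Euclidean norm of `z ∈ ℝ^(2m)`. -/
theorem mulq_blockDiag_opNorm_bound (σ : ℕ) (hσ : 1 ≤ σ) (m : ℕ)
    (z : EuclideanSpace ℝ (Fin m × Fin 2)) :
    ‖(Matrix.toEuclideanLin
        (blockDiag m z - blockDiag m (fun p => mulqQ σ (z p)))).toContinuousLinearMap‖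
      ≤ 0.5 / 10 ^ (σ - 1) * ‖z‖ := by
  rw [blockDiag_sub]
  exact opNorm_blockDiag_le (by positivity) fun p => abs_sub_mulqQ_le hσ (z p)
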